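/- Let G be a complete bipartite graph on L ∪ R with nonnegative edge weights w, where L = {u₁, …, uₙ} and n ≤ |R|. Let M₀ = ∅, and for each 1 ≤ t ≤ n let Mₜ be obtained from M_{t−1} in one of the following two ways: (i) Mₜ = M_{t−1} ∪ {(uₜ, v*)} for some v* ∈ R exposed with respect to M_{t−1}, or (ii) Mₜ = (M_{t−1} ∖ {(M_{t−1}(v), v)}) ∪ {(uₜ, v), (M_{t−1}(v), v_tail)} for some v ∈ R matched by M_{t−1} and some v_tail ∈ R exposed with respect to M_{t−1} satisfying w(M_{t−1}(v), v_tail) = max_{v′ ∈ R exposed w.r.t. M_{t−1}} w(M_{t−1}(v), v′); in either case the chosen option maximizes w(Mₜ) − w(M_{t−1}) over all options of forms (i) and (ii). Then Mₙ matches every vertex of L, and for every matching M* in G that matches every vertex of L, 2 · w(Mₙ) ≥ w(M*). -/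

import Mathlib

open scoped Classical

/-- `M` is a matching in the complete bipartite graph on `L ∪ R`:
a set of (left, right) pairs no two of which share an endpoint. -/
def IsBipMatching {L R : Type*} (M : Finset (L × R)) : Prop :=
  ∀ p ∈ M, ∀ q ∈ M, p ≠ q → p.1 ≠ q.1 ∧ p.2 ≠ q.2

/-- The set of right-side vertices exposed (unmatched) with respect to `M`. -/
noncomputable def exposedR {L R : Type*} [Fintype R] (M : Finset (L × R)) : Finset R :=
  Finset.univ.filter (fun r => ∀ x : L, (x, r) ∉ M)

/-- `max_{v' ∈ R exposed w.r.t. M} w m v'`, with the maximum over the empty set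
defined as `0`. -/
noncomputable def maxExpW {L R : Type*} [Fintype R] (w : L → R → ℝ)
    (M : Finset (L × R)) (m : L) : ℝ :=
  if h : (exposedR M).Nonempty then (exposedR M).sup' h (w m) else 0

/-- The total weight of the matching `M`. -/
noncomputable def wSum {L R : Type*} (w : L → R → ℝ) (M : Finset (L × R)) : ℝ :=
  ∑ p ∈ M, w p.1 p.2

/-- One step of the online algorithm for the newly arrived exposed vertex `u`:
`N` is obtained from `M` either (i) by matching `u` to an exposed vertex `v*`,
or (ii) by taking a matched vertex `v` away from its partner `m`, matching `u`
to `v`, and rematching `m` to an exposed vertex `v_tail` maximizing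
`w m ·` over exposed vertices. -/
def StepOption {L R : Type*} [Fintype R] (w : L → R → ℝ)
    (M : Finset (L × R)) (u : L) (N : Finset (L × R)) : Prop :=
  (∃ v' ∈ exposedR M, N = insert (u, v') M) ∨
  (∃ (v : R) (m : L) (vtail : R), (m, v) ∈ M ∧ vtail ∈ exposedR M ∧
      w m vtail = maxExpW w M m ∧
      N = insert (u, v) (insert (m, vtail) (M.erase (m, v))))

open Finset

lemma wSum_insert {L R : Type*} {w : L → R → ℝ} {M : Finset (L × R)} {p : L × R} (h : p ∉ M) :
    wSum w (insert p M) = w p.1 p.2 + wSum w M :=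
  sum_insert h

section Step

variable {L R : Type*} [Fintype R] {w : L → R → ℝ} {M N : Finset (L × R)}

lemma mem_exposedR {r : R} : r ∈ exposedR M ↔ ∀ x : L, (x, r) ∉ M := by
  simp [exposedR]

lemma le_maxExpW (x : L) {r : R} (hr : r ∈ exposedR M) : w x r ≤ maxExpW w M x := by
  have h : (exposedR M).Nonempty := ⟨r, hr⟩
  rw [maxExpW, dif_pos h]
  exact le_sup' (w x) hr

lemma exists_eq_maxExpW (x : L) (h : (exposedR M).Nonempty) :
    ∃ r ∈ exposedR M, w x r = maxExpW w M x := by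
  obtain ⟨r, hr, he⟩ := exists_mem_eq_sup' h (w x)
  exact ⟨r, hr, by rw [maxExpW, dif_pos h, he]⟩

lemma maxExpW_nonneg (hw : ∀ x y, 0 ≤ w x y) (x : L) : 0 ≤ maxExpW w M x := by
  by_cases h : (exposedR M).Nonempty
  · obtain ⟨r, -, he⟩ := exists_eq_maxExpW (w := w) x h
    exact he ▸ hw x r
  · rw [maxExpW, dif_neg h]

lemma maxExpW_anti (hw : ∀ x y, 0 ≤ w x y) (h : exposedR N ⊆ exposedR M) (x : L) :
    maxExpW w N x ≤ maxExpW w M x := by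
  by_cases hN : (exposedR N).Nonempty
  · obtain ⟨r, hr, he⟩ := exists_eq_maxExpW (w := w) x hN
    exact he ▸ le_maxExpW x (h hr)
  · rw [maxExpW, dif_neg hN]
    exact maxExpW_nonneg hw x

/-- The price of a right vertex `v`: the loss incurred when its partner is moved to its best
exposed neighbour, and `0` if `v` is exposed. -/
noncomputable def price (w : L → R → ℝ) (M : Finset (L × R)) (v : R) : ℝ :=
  ∑ q ∈ M.filter (fun q => q.2 = v), (w q.1 q.2 - maxExpW w M q.1)

lemma price_of_exposed {v : R} (hv : v ∈ exposedR M) : price w M v = 0 := by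
  rw [price, filter_eq_empty_iff.2, sum_empty]
  rintro ⟨x, r⟩ hq rfl
  exact mem_exposedR.1 hv x hq

lemma price_of_mem (hM : IsBipMatching M) {m : L} {v : R} (h : (m, v) ∈ M) :
    price w M v = w m v - maxExpW w M m := by
  have : M.filter (fun q => q.2 = v) = {(m, v)} := by
    ext q
    simp only [mem_filter, mem_singleton]
    constructor
    · rintro ⟨hq, hv⟩
      by_contra hne
      exact (hM q hq _ h hne).2 hv
    · rintro rfl
      exact ⟨h, rfl⟩
  rw [price, this, sum_singleton]

lemma sum_price_le (hw : ∀ x y, 0 ≤ w x y) : ∑ v, price w M v ≤ wSum w M := by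
  refine (sum_fiberwise M Prod.snd fun q => w q.1 q.2 - maxExpW w M q.1).trans_le ?_
  exact sum_le_sum fun q _ => sub_le_self _ (maxExpW_nonneg hw q.1)

lemma wSum_augment {u m : L} {v r : R} (hu : ∀ y, (u, y) ∉ M) (hm : (m, v) ∈ M)
    (hr : r ∈ exposedR M) :
    wSum w (insert (u, v) (insert (m, r) (M.erase (m, v)))) =
      wSum w M + w u v + w m r - w m v := by
  have hum : u ≠ m := by rintro rfl; exact hu _ hm
  have hr' := mem_exposedR.1 hr
  have he : w m v + wSum w (M.erase (m, v)) = wSum w M :=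
    add_sum_erase M (fun p => w p.1 p.2) hm
  rw [wSum_insert (by simp [hum, hu]), wSum_insert (by simp [hr'])]
  linarith

lemma StepOption.exposedR_nonempty {u : L} (h : StepOption w M u N) : (exposedR M).Nonempty := by
  rcases h with ⟨r, hr, -⟩ | ⟨-, -, r, -, hr, -⟩ <;> exact ⟨r, hr⟩

lemma StepOption.isBipMatching {u : L} (h : StepOption w M u N) (hM : IsBipMatching M)
    (hu : ∀ y, (u, y) ∉ M) : IsBipMatching N := by
  rcases h with ⟨r, hr, rfl⟩ | ⟨v, m, r, hm, hr, -, rfl⟩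
  · rw [mem_exposedR] at hr
    rintro ⟨a, b⟩ hp ⟨c, d⟩ hq hne
    have key := fun ha hb => hM (a, b) ha (c, d) hb hne
    simp only [mem_insert, Prod.mk.injEq, ne_eq] at hp hq hne key ⊢
    grind
  · rw [mem_exposedR] at hr
    rintro ⟨a, b⟩ hp ⟨c, d⟩ hq hne
    have hab := hM (m, v) hm (a, b)
    have hcd := hM (m, v) hm (c, d)
    have key := fun ha hb => hM (a, b) ha (c, d) hb hne
    simp only [mem_insert, mem_erase, Prod.mk.injEq, ne_eq] at hp hq hne key hab hcd ⊢
    grind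

lemma StepOption.exposedR_subset {u : L} (h : StepOption w M u N) :
    exposedR N ⊆ exposedR M := by
  intro y hy
  rw [mem_exposedR] at hy ⊢
  intro x hx
  rcases h with ⟨r, hr, rfl⟩ | ⟨v, m, r, hm, hr, -, rfl⟩
  · exact hy x (mem_insert_of_mem hx)
  · by_cases hv : y = v
    · subst hv
      exact hy u (mem_insert_self _ _)
    · exact hy x (by simp [hx, hv])

lemma StepOption.exists_mem_iff {u : L} (h : StepOption w M u N) (x : L) :
    (∃ y, (x, y) ∈ N) ↔ x = u ∨ ∃ y, (x, y) ∈ M := by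
  rcases h with ⟨r, hr, rfl⟩ | ⟨v, m, r, hm, hr, -, rfl⟩
  · simp only [mem_insert, Prod.mk.injEq]
    grind
  · simp only [mem_insert, mem_erase, Prod.mk.injEq, ne_eq]
    grind

/-- The profit of an optimal step is at least the weight of any edge at the new vertex minus the
price of its right endpoint. -/
lemma StepOption.sub_price_le {u : L} (h : StepOption w M u N) (hM : IsBipMatching M)
    (hu : ∀ y, (u, y) ∉ M) (hopt : ∀ N', StepOption w M u N' → wSum w N' ≤ wSum w N) (v : R) :
    w u v - price w M v ≤ wSum w N - wSum w M := by
  by_cases hv : v ∈ exposedR M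
  · have := hopt _ (Or.inl ⟨v, hv, rfl⟩)
    rw [wSum_insert (hu v)] at this
    rw [price_of_exposed hv]
    linarith
  · obtain ⟨m, hm⟩ : ∃ m, (m, v) ∈ M := by simpa [mem_exposedR] using hv
    obtain ⟨r, hr, he⟩ := exists_eq_maxExpW (w := w) m h.exposedR_nonempty
    have := hopt _ (Or.inr ⟨v, m, r, hm, hr, he, rfl⟩)
    rw [wSum_augment hu hm hr] at this
    rw [price_of_mem hM hm]
    linarith

/-- Prices do not decrease along optimal steps. -/
lemma StepOption.price_mono {u : L} (h : StepOption w M u N) (hw : ∀ x y, 0 ≤ w x y)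
    (hM : IsBipMatching M) (hu : ∀ y, (u, y) ∉ M)
    (hopt : ∀ N', StepOption w M u N' → wSum w N' ≤ wSum w N) (v : R) :
    price w M v ≤ price w N v := by
  have hN := h.isBipMatching hM hu
  have hanti := maxExpW_anti (w := w) hw h.exposedR_subset
  by_cases hv : v ∈ exposedR N
  · rw [price_of_exposed hv, price_of_exposed (h.exposedR_subset hv)]
  obtain ⟨m, hm⟩ : ∃ m, (m, v) ∈ N := by simpa [mem_exposedR] using hv
  rw [price_of_mem hN hm]
  have hmax : maxExpW w M u ≤ wSum w N - wSum w M := by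
    obtain ⟨r, hr, he⟩ := exists_eq_maxExpW (w := w) u h.exposedR_nonempty
    have := h.sub_price_le hM hu hopt r
    rw [price_of_exposed hr] at this
    linarith
  have hold : (m, v) ∈ M → price w M v ≤ w m v - maxExpW w N m := fun hmM => by
    rw [price_of_mem hM hmM]
    linarith [hanti m]
  have hmu := hanti u
  rcases h with ⟨r, hr, rfl⟩ | ⟨v', m', r, hm', hr, he, rfl⟩
  · rw [wSum_insert (hu r)] at hmax
    rcases mem_insert.1 hm with heq | hmM
    · obtain ⟨rfl, rfl⟩ := Prod.mk.inj heq
      rw [price_of_exposed hr]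
      linarith
    · exact hold hmM
  · rw [wSum_augment hu hm' hr] at hmax
    rcases mem_insert.1 hm with heq | hm
    · obtain ⟨rfl, rfl⟩ := Prod.mk.inj heq
      rw [price_of_mem hM hm']
      linarith
    rcases mem_insert.1 hm with heq | hmM
    · obtain ⟨rfl, rfl⟩ := Prod.mk.inj heq
      rw [price_of_exposed hr]
      linarith [hanti m]
    · exact hold (mem_of_mem_erase hmM)

end Step

/-- The online algorithm for maximum-weight left-perfect bipartite matching under
vertex arrivals with reassignment budget 4 is `1/2`-competitive: with
`L = Fin n`, `n ≤ |R|`, and nonnegative weights `w`, if at each timestep `t` the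
matching `M (t+1)` is obtained from `M t` by a step option for the newly arrived
vertex `t` maximizing the marginal profit, then the final matching `M n` is
left-perfect and `2 · w(M n) ≥ w(M*)` for every left-perfect matching `M*`. -/
theorem stmt14 {R : Type*} [Fintype R] [DecidableEq R]
    (n : ℕ) (hn : n ≤ Fintype.card R)
    (w : Fin n → R → ℝ) (hw : ∀ (x : Fin n) (y : R), 0 ≤ w x y)
    (M : ℕ → Finset (Fin n × R)) (hM0 : M 0 = ∅)
    (hstep : ∀ t : Fin n,
      StepOption w (M t) t (M ((t : ℕ) + 1)) ∧
      ∀ N : Finset (Fin n × R), StepOption w (M t) t N →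
        wSum w N - wSum w (M t) ≤ wSum w (M ((t : ℕ) + 1)) - wSum w (M t)) :
    (∀ i : Fin n, ∃ r : R, (i, r) ∈ M n) ∧
    (∀ Mstar : Finset (Fin n × R), IsBipMatching Mstar →
      (∀ i : Fin n, ∃ r : R, (i, r) ∈ Mstar) →
      wSum w Mstar ≤ 2 * wSum w (M n)) := by
  have hopt : ∀ t : Fin n, ∀ N, StepOption w (M t) t N → wSum w N ≤ wSum w (M ((t : ℕ) + 1)) :=
    fun t N hN => by linarith [(hstep t).2 N hN]
  have inv : ∀ t ≤ n, IsBipMatching (M t) ∧ ∀ i : Fin n, (∃ r, (i, r) ∈ M t) ↔ (i : ℕ) < t := by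
    intro t
    induction t with
    | zero => simp [hM0, IsBipMatching]
    | succ t ih =>
      intro ht
      obtain ⟨hM, hl⟩ := ih (by omega)
      have hs := (hstep ⟨t, ht⟩).1
      refine ⟨hs.isBipMatching hM fun y hy => ?_, fun i => ?_⟩
      · exact lt_irrefl _ ((hl ⟨t, ht⟩).1 ⟨y, hy⟩)
      · rw [hs.exists_mem_iff, hl, Fin.ext_iff]
        dsimp only
        omega
  have hnew : ∀ t : Fin n, ∀ y, (t, y) ∉ M t := fun t y hy =>
    lt_irrefl _ (((inv t t.2.le).2 t).1 ⟨y, hy⟩)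
  refine ⟨fun i => ((inv n le_rfl).2 i).2 i.2, fun Mstar hMstar hperf => ?_⟩
  have hmono : ∀ v, ∀ t ≤ n, ∀ s ≤ t, price w (M s) v ≤ price w (M t) v := by
    intro v t
    induction t with
    | zero => intro _ s hs; rw [Nat.le_zero.1 hs]
    | succ t ih =>
      intro ht s hs
      rcases hs.eq_or_lt with rfl | hs
      · rfl
      · exact (ih (by omega) s (by omega)).trans
          ((hstep ⟨t, ht⟩).1.price_mono hw (inv t (by omega)).1 (hnew ⟨t, ht⟩) (hopt ⟨t, ht⟩) v)
  have hnonneg : ∀ v, 0 ≤ price w (M n) v := fun v => by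
    have h0 : price w (M 0) v = 0 := price_of_exposed (by simp [mem_exposedR, hM0])
    exact h0 ▸ hmono v n le_rfl 0 (Nat.zero_le n)
  have hedge : ∀ p ∈ Mstar, w p.1 p.2 ≤
      (wSum w (M ((p.1 : ℕ) + 1)) - wSum w (M p.1)) + price w (M n) p.2 := fun p _ => by
    have := (hstep p.1).1.sub_price_le (inv p.1 p.1.2.le).1 (hnew p.1) (hopt p.1) p.2
    linarith [hmono p.2 n le_rfl p.1 p.1.2.le]
  have hfst : Set.InjOn Prod.fst (Mstar : Set (Fin n × R)) := fun p hp q hq h => by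
    by_contra hne
    exact (hMstar p hp q hq hne).1 h
  have hsnd : Set.InjOn Prod.snd (Mstar : Set (Fin n × R)) := fun p hp q hq h => by
    by_contra hne
    exact (hMstar p hp q hq hne).2 h
  have himage : Mstar.image Prod.fst = univ := by
    ext i
    simpa using hperf i
  have hprofit : ∑ p ∈ Mstar, (wSum w (M ((p.1 : ℕ) + 1)) - wSum w (M p.1)) = wSum w (M n) := by
    rw [← sum_image (f := fun i : Fin n => wSum w (M ((i : ℕ) + 1)) - wSum w (M i)) hfst, himage,
      Fin.sum_univ_eq_sum_range (fun i => wSum w (M (i + 1)) - wSum w (M i)),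
      sum_range_sub (fun i => wSum w (M i))]
    simp [hM0, wSum]
  have hprice : ∑ p ∈ Mstar, price w (M n) p.2 ≤ wSum w (M n) := by
    rw [← sum_image (f := fun v => price w (M n) v) hsnd]
    exact (sum_le_univ_sum_of_nonneg hnonneg).trans (sum_price_le hw)
  have htotal := sum_le_sum hedge
  rw [sum_add_distrib, hprofit] at htotal
  rw [wSum]
  linarith
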